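/- Assume the norm ‖·‖ on ℝ³ is admissible. If the affine fundamental form h of an immersed surface f : M → ℝ³ (endowed with a Birkhoff normal field η) has rank 2 at a point p ∈ M and is indefinite at p, then the tangent space T_pM admits a basis consisting of eigenvectors of the differential dη_p : T_pM → T_pM (moreover det(dη_p) < 0). -/

import Mathlib

/-!
Differential geometry of immersed surfaces in three-dimensional normed
(Minkowski) spaces, following Balestro–Martini–Teixeira.

`E3 = ℝ³` carries its standard Euclidean inner product and, in addition, a
norm `N` which is strictly convex and smooth.  Surfaces are given in a local
parametrization `f : P2 → E3` (an immersion on an open set `U`), endowed with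
a Birkhoff normal field `η`.
-/

noncomputable section

open scoped InnerProductSpace

abbrev E3 := EuclideanSpace ℝ (Fin 3)
abbrev P2 := EuclideanSpace ℝ (Fin 2)

/-- A smooth, strictly convex norm on `ℝ³` (a Minkowski norm). -/
structure MinkowskiNorm3 where
  N : E3 → ℝ
  nonneg : ∀ x, 0 ≤ N x
  eq_zero_iff : ∀ x, N x = 0 ↔ x = 0
  smul_eq : ∀ (c : ℝ) (x : E3), N (c • x) = |c| * N x
  triangle : ∀ x y, N (x + y) ≤ N x + N y
  strict_triangle : ∀ x y : E3, LinearIndependent ℝ ![x, y] → N (x + y) < N x + N y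
  smooth : ContDiffOn ℝ (⊤ : ℕ∞) N {x : E3 | x ≠ 0}

namespace MinkowskiNorm3

/-- Birkhoff orthogonality of a vector `v` to a set (e.g. a plane) `H`:
`‖v + w‖ ≥ ‖v‖` for all `w ∈ H`. -/
def BirkhoffOrth (m : MinkowskiNorm3) (v : E3) (H : Set E3) : Prop :=
  ∀ w ∈ H, m.N v ≤ m.N (v + w)

/-- The (outward) Euclidean Gauss map of the unit sphere `∂B` of the norm,
expressed on ambient space as the normalized gradient of `N`.  Restricted to
`∂B` it is the map `u⁻¹ : ∂B → ∂B_e`, whose inverse is `u : ∂B_e → ∂B`. -/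
def sphereGauss (m : MinkowskiNorm3) (v : E3) : E3 :=
  ‖gradient m.N v‖⁻¹ • gradient m.N v

/-- The differential `du⁻¹` at a point `v ∈ ∂B`, applied to a vector `w`
(its restriction to the tangent plane of `∂B` at `v` is the inverse of
`du_{u⁻¹(v)}`). -/
def duInv (m : MinkowskiNorm3) (v w : E3) : E3 :=
  fderiv ℝ m.sphereGauss v w

/-- Admissibility of the norm: the unit sphere `∂B` has positive Euclidean
Gaussian curvature at every point; equivalently, the second fundamental form
of `∂B` with respect to the outward normal is positive definite, i.e.
`⟪du⁻¹ w, w⟫ > 0` for every nonzero vector `w` tangent to `∂B`. -/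
def Admissible (m : MinkowskiNorm3) : Prop :=
  ∀ v : E3, m.N v = 1 → ∀ w : E3, w ≠ 0 → fderiv ℝ m.N v w = 0 →
    0 < ⟪m.duInv v w, w⟫_ℝ

end MinkowskiNorm3

/-- An immersed surface (in a local parametrization on an open set `U ⊆ ℝ²`)
in the Minkowski space `(ℝ³, m)`, endowed with a Birkhoff normal vector
field `η`: a smooth unit field with `η(p) ⊣_B T_pM` for all `p`. -/
structure BSurface (m : MinkowskiNorm3) where
  U : Set P2
  isOpen : IsOpen U
  f : P2 → E3
  smooth_f : ContDiffOn ℝ (⊤ : ℕ∞) f U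
  immersion : ∀ p ∈ U, Function.Injective (fderiv ℝ f p)
  η : P2 → E3
  smooth_η : ContDiffOn ℝ (⊤ : ℕ∞) η U
  unit_η : ∀ p ∈ U, m.N (η p) = 1
  birkhoff : ∀ p ∈ U, m.BirkhoffOrth (η p) (Set.range (fderiv ℝ f p))

namespace BSurface

variable {m : MinkowskiNorm3}

/-- The tangent plane `T_pM`, identified (via the push-forward `df_p`) with a
linear plane in ambient `ℝ³`. -/
def tangent (S : BSurface m) (p : P2) : Set E3 := Set.range (fderiv ℝ S.f p)

/-- `h : P2 → P2 → ℝ` (in the parameter coordinates, i.e. `h v w` stands for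
`h(df_p v, df_p w)`) is the affine fundamental form of the immersion at `p`,
determined by the Gauss formula `D_X Y = ∇_X Y + h(X,Y) η`: for coordinate
directions `v, w`, the second derivative `D_v D_w f` minus `h v w • η p` is
tangential. -/
def IsAffineFundForm (S : BSurface m) (p : P2) (h : P2 → P2 → ℝ) : Prop :=
  ∀ v w : P2,
    fderiv ℝ (fun q => fderiv ℝ S.f q w) p v - h v w • S.η p ∈ S.tangent p

end BSurface

/-- The Minkowski normal curvature of the surface parametrized by `f` with
Birkhoff normal field `η`, at `p`, in the tangent direction `X = df_p v`:
`k_{M,p}(X) = ⟪du⁻¹_{η(p)} X, dη_p X⟫ / ⟪du⁻¹_{η(p)} X, X⟫`, using the natural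
identification of the parallel planes `T_pM ≅ T_{η(p)}∂B ≅ T_{ξ(p)}∂B_e`. -/
def normalCurv (m : MinkowskiNorm3) (f η : P2 → E3) (p v : P2) : ℝ :=
  ⟪m.duInv (η p) (fderiv ℝ f p v), fderiv ℝ η p v⟫_ℝ /
    ⟪m.duInv (η p) (fderiv ℝ f p v), fderiv ℝ f p v⟫_ℝ

/-- A linear map on a plane with negative determinant, in the basis `v, w`, has a basis of
eigenvectors, with eigenvalues of opposite signs. The map is read through an auxiliary map `A`. -/
lemma exists_eigenvectors_of_det_neg {V W : Type*} [AddCommGroup V] [Module ℝ V]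
    [AddCommGroup W] [Module ℝ W] (A D : V →ₗ[ℝ] W) {v w : V}
    (hvw : LinearIndependent ℝ ![v, w]) {a b c d : ℝ}
    (hv : D v = a • A v + c • A w) (hw : D w = b • A v + d • A w) (hdet : a * d - b * c < 0) :
    ∃ v₁ v₂ : V, LinearIndependent ℝ ![v₁, v₂] ∧
      ∃ μ₁ μ₂ : ℝ, D v₁ = μ₁ • A v₁ ∧ D v₂ = μ₂ • A v₂ ∧ μ₁ * μ₂ < 0 := by
  rw [LinearIndependent.pair_iff] at hvw
  rcases eq_or_ne b 0 with rfl | hb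
  · have had : a - d ≠ 0 := by
      intro h
      obtain rfl : a = d := by linarith
      nlinarith [mul_self_nonneg a]
    refine ⟨v + (c / (a - d)) • w, w, ?_, a, d, ?_, ?_, by linarith⟩
    · rw [LinearIndependent.pair_iff]
      intro s t hst
      have := hvw s (s * (c / (a - d)) + t) (by rw [← hst]; module)
      refine ⟨this.1, ?_⟩
      have h2 := this.2
      rw [this.1] at h2
      simpa using h2
    · rw [map_add, map_add, map_smul, map_smul, hv, hw]
      have : c + (c / (a - d)) * d = a * (c / (a - d)) := by field_simp; ring
      linear_combination (norm := module) this • A w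
    · rw [hw]; module
  · set s := Real.sqrt ((a - d) ^ 2 + 4 * (b * c)) with hs
    have hpos : 0 < (a - d) ^ 2 + 4 * (b * c) := by nlinarith [sq_nonneg (a + d)]
    have hs2 : s * s = (a - d) ^ 2 + 4 * (b * c) := Real.mul_self_sqrt hpos.le
    have hs0 : 0 < s := Real.sqrt_pos.2 hpos
    have eig : ∀ μ : ℝ, μ * μ - (a + d) * μ + (a * d - b * c) = 0 →
        D (b • v + (μ - a) • w) = μ • A (b • v + (μ - a) • w) := by
      intro μ hμ
      rw [map_add, map_add, map_smul, map_smul, map_smul, map_smul, hv, hw]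
      have : b * c + (μ - a) * d = μ * (μ - a) := by linarith
      linear_combination (norm := module) this • A w
    refine ⟨b • v + ((a + d + s) / 2 - a) • w, b • v + ((a + d - s) / 2 - a) • w, ?_,
      (a + d + s) / 2, (a + d - s) / 2, eig _ (by linarith), eig _ (by linarith), by linarith⟩
    rw [LinearIndependent.pair_iff]
    intro x y hxy
    obtain ⟨h1, h2⟩ := hvw ((x + y) * b)
      (x * ((a + d + s) / 2 - a) + y * ((a + d - s) / 2 - a)) (by rw [← hxy]; module)
    have hy : y = -x := by
      have := (mul_eq_zero.1 h1).resolve_right hb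
      linarith
    subst hy
    have : x * s = 0 := by linarith
    have := (mul_eq_zero.1 this).resolve_right hs0.ne'
    simp [this]

/-- A bilinear form, not necessarily symmetric, which is positive definite on a plane has positive
determinant there. -/
lemma gram_det_pos {V : Type*} [AddCommGroup V] [Module ℝ V] (H : V →ₗ[ℝ] V →ₗ[ℝ] ℝ) {x y : V}
    (hpos : ∀ s t : ℝ, s • x + t • y ≠ 0 → 0 < H (s • x + t • y) (s • x + t • y))
    (hxy : LinearIndependent ℝ ![x, y]) : 0 < H x x * H y y - H x y * H y x := by
  rw [LinearIndependent.pair_iff] at hxy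
  have hne : ∀ s t : ℝ, s ≠ 0 → s • x + t • y ≠ 0 := fun s t hs h => hs (hxy s t h).1
  have hx : 0 < H x x := by simpa using hpos 1 0 (hne 1 0 one_ne_zero)
  have key := hpos (-(H x y + H y x)) (2 * H x x) (fun h => by linarith [(hxy _ _ h).2])
  simp only [map_add, map_smul, LinearMap.add_apply, LinearMap.smul_apply, smul_eq_mul] at key
  nlinarith [sq_nonneg (H x y - H y x)]

lemma linearIndependent_pair_of_pos_of_neg {V : Type*} [AddCommGroup V] [Module ℝ V]
    (h : V →ₗ[ℝ] V →ₗ[ℝ] ℝ) {v w : V} (hv : 0 < h v v) (hw : h w w < 0) :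
    LinearIndependent ℝ ![v, w] := by
  have hv0 : v ≠ 0 := by rintro rfl; simp at hv
  rw [LinearIndependent.pair_iff' hv0]
  rintro a rfl
  simp only [map_smul, LinearMap.smul_apply, smul_eq_mul] at hw
  nlinarith [mul_self_nonneg a]

/-- A functional nonzero on a three-dimensional space has kernel equal to any plane it kills. -/
lemma mem_range_of_mem_ker {A : P2 →ₗ[ℝ] E3} (hA : Function.Injective A) {L : E3 →ₗ[ℝ] ℝ}
    (hL : L ≠ 0) (hLA : ∀ v, L (A v) = 0) {x : E3} (hx : L x = 0) : ∃ u, A u = x := by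
  have hle : LinearMap.range A ≤ LinearMap.ker L := by
    rintro _ ⟨v, rfl⟩
    exact hLA v
  have h1 : Module.finrank ℝ (LinearMap.range A) = 2 := by
    rw [LinearMap.finrank_range_of_inj hA]; simp
  have h2 := Module.Dual.finrank_ker_add_one_of_ne_zero hL
  have h3 : Module.finrank ℝ E3 = 3 := by simp
  have heq := Submodule.eq_of_le_of_finrank_eq hle (by omega)
  have : x ∈ LinearMap.range A := by rw [heq]; exact hx
  exact this

namespace MinkowskiNorm3

variable (m : MinkowskiNorm3)

lemma ne_zero_of_unit {x : E3} (hx : m.N x = 1) : x ≠ 0 := by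
  rintro rfl
  simp [(m.eq_zero_iff 0).2 rfl] at hx

lemma contDiffAt {x : E3} (hx : x ≠ 0) : ContDiffAt ℝ (⊤ : ℕ∞) m.N x :=
  (m.smooth x hx).contDiffAt (isOpen_ne.mem_nhds hx)

lemma differentiableAt {x : E3} (hx : x ≠ 0) : DifferentiableAt ℝ m.N x :=
  (m.contDiffAt hx).differentiableAt (by simp)

lemma differentiableAt_fderiv {x : E3} (hx : x ≠ 0) : DifferentiableAt ℝ (fderiv ℝ m.N) x :=
  ((m.contDiffAt hx).fderiv_right (m := 1) (by norm_cast)).differentiableAt (by simp)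

lemma hasDerivAt_line {x : E3} (hx : x ≠ 0) (y : E3) :
    HasDerivAt (fun t : ℝ => m.N (x + t • y)) (fderiv ℝ m.N x y) 0 := by
  have h1 : HasDerivAt (fun t : ℝ => x + t • y) y 0 := by
    simpa using ((hasDerivAt_id (0 : ℝ)).smul_const y).const_add x
  have h2 : HasFDerivAt m.N (fderiv ℝ m.N x) (x + (0 : ℝ) • y) := by
    simpa using (m.differentiableAt hx).hasFDerivAt
  exact h2.comp_hasDerivAt 0 h1

/-- Euler's identity. -/
lemma fderiv_self {x : E3} (hx : x ≠ 0) : fderiv ℝ m.N x x = m.N x := by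
  have h1 : HasDerivAt (fun t : ℝ => (1 + t) * m.N x) (m.N x) 0 := by
    simpa using ((hasDerivAt_id (0 : ℝ)).const_add 1).mul_const (m.N x)
  refine (m.hasDerivAt_line hx x).unique (h1.congr_of_eventuallyEq ?_)
  filter_upwards [lt_mem_nhds (show (-1 : ℝ) < 0 by norm_num)] with t ht
  have : x + t • x = (1 + t) • x := by module
  rw [this, m.smul_eq, abs_of_pos (by linarith)]

lemma fderiv_eq_zero_of_birkhoffOrth {x : E3} (hx : x ≠ 0) {A : P2 →L[ℝ] E3}
    (h : m.BirkhoffOrth x (Set.range A)) (v : P2) : fderiv ℝ m.N x (A v) = 0 := by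
  refine IsLocalMin.hasDerivAt_eq_zero (Filter.Eventually.of_forall fun t => ?_)
    (m.hasDerivAt_line hx (A v))
  simpa using h (t • A v) ⟨t • v, by simp⟩

/-- On the plane tangent to the sphere, `⟪du⁻¹ w, w⟫` is a positive multiple of the Hessian of the
norm. -/
lemma inner_duInv {x w : E3} (hx : m.N x = 1) (hw : fderiv ℝ m.N x w = 0) :
    ⟪m.duInv x w, w⟫_ℝ = ‖gradient m.N x‖⁻¹ * fderiv ℝ (fderiv ℝ m.N) x w w := by
  have hx0 := m.ne_zero_of_unit hx
  have hinner : ∀ z y, ⟪gradient m.N z, y⟫_ℝ = fderiv ℝ m.N z y := fun z y => by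
    simp [gradient]
  have hne : gradient m.N x ≠ 0 := by
    intro h
    have h1 := m.fderiv_self hx0
    rw [← hinner, h, hx] at h1
    simp at h1
  have hG : HasFDerivAt (gradient m.N)
      ((InnerProductSpace.toDual ℝ E3).symm.toContinuousLinearEquiv.toContinuousLinearMap ∘L
        fderiv ℝ (fderiv ℝ m.N) x) x :=
    ((InnerProductSpace.toDual ℝ E3).symm.toContinuousLinearEquiv.toContinuousLinearMap.hasFDerivAt
      ).comp x (m.differentiableAt_fderiv hx0).hasFDerivAt
  have hc := ((hG.differentiableAt.norm ℝ hne).inv (norm_ne_zero_iff.2 hne)).hasFDerivAt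
  have hS := (hc.smul hG).fderiv
  have hS' : fderiv ℝ m.sphereGauss x = _ := hS
  rw [duInv, hS']
  simp [inner_add_left, inner_smul_left, hinner, hw]

lemma hessian_pos (hadm : m.Admissible) {x w : E3} (hx : m.N x = 1) (hw0 : w ≠ 0)
    (hw : fderiv ℝ m.N x w = 0) : 0 < fderiv ℝ (fderiv ℝ m.N) x w w := by
  have h := hadm x hx w hw0 hw
  rw [m.inner_duInv hx hw] at h
  exact pos_of_mul_pos_right h (by positivity)

end MinkowskiNorm3

namespace BSurface

variable {m : MinkowskiNorm3} (S : BSurface m) {p : P2}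

lemma contDiffAt_f (hp : p ∈ S.U) : ContDiffAt ℝ (⊤ : ℕ∞) S.f p :=
  S.smooth_f.contDiffAt (S.isOpen.mem_nhds hp)

lemma differentiableAt_η (hp : p ∈ S.U) : DifferentiableAt ℝ S.η p :=
  (S.smooth_η.contDiffAt (S.isOpen.mem_nhds hp)).differentiableAt (by simp)

lemma differentiableAt_fderiv_f (hp : p ∈ S.U) : DifferentiableAt ℝ (fderiv ℝ S.f) p :=
  ((S.contDiffAt_f hp).fderiv_right (m := 1) (by norm_cast)).differentiableAt (by simp)

lemma η_ne_zero (hp : p ∈ S.U) : S.η p ≠ 0 := m.ne_zero_of_unit (S.unit_η p hp)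

lemma fderiv_N_tangent (hp : p ∈ S.U) (v : P2) :
    fderiv ℝ m.N (S.η p) (fderiv ℝ S.f p v) = 0 :=
  m.fderiv_eq_zero_of_birkhoffOrth (S.η_ne_zero hp) (S.birkhoff p hp) v

lemma fderiv_N_η (hp : p ∈ S.U) (v : P2) :
    fderiv ℝ m.N (S.η p) (fderiv ℝ S.η p v) = 0 := by
  have h1 := (m.differentiableAt (S.η_ne_zero hp)).hasFDerivAt.comp p
    (S.differentiableAt_η hp).hasFDerivAt
  have h2 : HasFDerivAt (m.N ∘ S.η) (0 : P2 →L[ℝ] ℝ) p := by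
    refine (hasFDerivAt_const (1 : ℝ) p).congr_of_eventuallyEq ?_
    filter_upwards [S.isOpen.mem_nhds hp] with q hq using S.unit_η q hq
  simpa using congrArg (fun L : P2 →L[ℝ] ℝ => L v) (h1.unique h2)

/-- The differential of the Birkhoff normal maps into the tangent plane. -/
lemma fderiv_η_mem_tangent (hp : p ∈ S.U) (v : P2) : fderiv ℝ S.η p v ∈ S.tangent p := by
  refine mem_range_of_mem_ker (A := (fderiv ℝ S.f p).toLinearMap) (S.immersion p hp)
    (L := (fderiv ℝ m.N (S.η p)).toLinearMap) ?_ (S.fderiv_N_tangent hp) (S.fderiv_N_η hp v)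
  intro h
  have h1 := m.fderiv_self (S.η_ne_zero hp)
  rw [S.unit_η p hp] at h1
  have h2 := congrArg (fun L : E3 →ₗ[ℝ] ℝ => L (S.η p)) h
  simp [h1] at h2

lemma fderiv_fderiv_apply (hp : p ∈ S.U) (v w : P2) :
    fderiv ℝ (fun q => fderiv ℝ S.f q w) p v = fderiv ℝ (fderiv ℝ S.f) p v w := by
  rw [fderiv_clm_apply (S.differentiableAt_fderiv_f hp) (differentiableAt_const w)]
  simp

variable {S} {h : P2 → P2 → ℝ}

lemma IsAffineFundForm.eq_fderiv_N (hh : S.IsAffineFundForm p h) (hp : p ∈ S.U) (v w : P2) :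
    h v w = fderiv ℝ m.N (S.η p) (fderiv ℝ (fderiv ℝ S.f) p v w) := by
  obtain ⟨u, hu⟩ := hh v w
  have h1 := S.fderiv_N_tangent hp u
  rw [hu, map_sub, map_smul, m.fderiv_self (S.η_ne_zero hp), S.unit_η p hp,
    S.fderiv_fderiv_apply hp] at h1
  simp only [smul_eq_mul, mul_one] at h1
  linarith

lemma IsAffineFundForm.symm (hh : S.IsAffineFundForm p h) (hp : p ∈ S.U) (v w : P2) :
    h v w = h w v := by
  rw [hh.eq_fderiv_N hp, hh.eq_fderiv_N hp,
    ((S.contDiffAt_f hp).isSymmSndFDerivAt (by simp; exact WithTop.coe_le_coe.2 le_top)) v w]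

/-- The affine fundamental form in terms of the Hessian of the norm and the differential of the
Birkhoff normal. -/
lemma IsAffineFundForm.eq_neg_hessian (hh : S.IsAffineFundForm p h) (hp : p ∈ S.U) (v w : P2) :
    h v w = -fderiv ℝ (fderiv ℝ m.N) (S.η p) (fderiv ℝ S.η p v) (fderiv ℝ S.f p w) := by
  have h1 := (m.differentiableAt_fderiv (S.η_ne_zero hp)).hasFDerivAt.comp p
    (S.differentiableAt_η hp).hasFDerivAt
  have h2 := h1.clm_apply
    ((S.differentiableAt_fderiv_f hp).hasFDerivAt.clm_apply (hasFDerivAt_const w p))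
  have h3 : HasFDerivAt
      (fun q => (fderiv ℝ m.N ∘ S.η) q (fderiv ℝ S.f q w)) (0 : P2 →L[ℝ] ℝ) p := by
    refine (hasFDerivAt_const (0 : ℝ) p).congr_of_eventuallyEq ?_
    filter_upwards [S.isOpen.mem_nhds hp] with q hq using S.fderiv_N_tangent hq w
  have h4 := congrArg (fun L : P2 →L[ℝ] ℝ => L v) (h2.unique h3)
  simp at h4
  rw [hh.eq_fderiv_N hp]
  linarith

end BSurface

/-- For an admissible norm: if the affine fundamental form `h`
has rank `2` at `p` and is indefinite there, then `T_pM` admits a basis of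
eigenvectors of `dη_p`; moreover `det (dη_p) < 0`. -/
theorem rank_two_indefinite_diagonalizable (m : MinkowskiNorm3)
    (hadm : m.Admissible) (S : BSurface m)
    (p : P2) (hp : p ∈ S.U) (h : P2 → P2 → ℝ)
    (hh : S.IsAffineFundForm p h)
    (hindef : (∃ v : P2, 0 < h v v) ∧ (∃ w : P2, h w w < 0)) :
    ∃ v₁ v₂ : P2, LinearIndependent ℝ ![v₁, v₂] ∧
      ∃ μ₁ μ₂ : ℝ, fderiv ℝ S.η p v₁ = μ₁ • fderiv ℝ S.f p v₁ ∧
        fderiv ℝ S.η p v₂ = μ₂ • fderiv ℝ S.f p v₂ ∧ μ₁ * μ₂ < 0 := by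
  obtain ⟨⟨v, hv⟩, ⟨w, hw⟩⟩ := hindef
  have hlin : LinearIndependent ℝ ![v, w] := by
    let h' : P2 →ₗ[ℝ] P2 →ₗ[ℝ] ℝ := LinearMap.mk₂ ℝ h
      (fun _ _ _ => by simp [hh.eq_fderiv_N hp]) (fun _ _ _ => by simp [hh.eq_fderiv_N hp])
      (fun _ _ _ => by simp [hh.eq_fderiv_N hp]) (fun _ _ _ => by simp [hh.eq_fderiv_N hp])
    exact linearIndependent_pair_of_pos_of_neg h' hv hw
  have hspan : ∀ u : P2, ∃ a b : ℝ, a • v + b • w = u := fun u => by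
    have := hlin.span_eq_top_of_card_eq_finrank (by simp)
    rw [Matrix.range_cons_cons_empty] at this
    exact Submodule.mem_span_pair.1 (this ▸ Submodule.mem_top)
  have hcoord : ∀ z : P2, ∃ a b : ℝ,
      fderiv ℝ S.η p z = a • fderiv ℝ S.f p v + b • fderiv ℝ S.f p w := fun z => by
    obtain ⟨u, hu⟩ := S.fderiv_η_mem_tangent hp z
    obtain ⟨a, b, rfl⟩ := hspan u
    exact ⟨a, b, by simp [← hu]⟩
  obtain ⟨a, c, hDv⟩ := hcoord v
  obtain ⟨b, d, hDw⟩ := hcoord w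
  refine exists_eigenvectors_of_det_neg (fderiv ℝ S.f p).toLinearMap (fderiv ℝ S.η p).toLinearMap
    hlin hDv hDw ?_
  set H : E3 →ₗ[ℝ] E3 →ₗ[ℝ] ℝ := (fderiv ℝ (fderiv ℝ m.N) (S.η p)).toLinearMap₁₂ with hH
  have hAlin : LinearIndependent ℝ ![fderiv ℝ S.f p v, fderiv ℝ S.f p w] := by
    rw [LinearIndependent.pair_iff] at hlin ⊢
    intro s t hst
    refine hlin s t (S.immersion p hp ?_)
    simpa using hst
  have hgram := gram_det_pos H (fun s t hne => m.hessian_pos hadm (S.unit_η p hp) hne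
    (by simp [S.fderiv_N_tangent hp])) hAlin
  have hform : ∀ x y, h x y = -H (fderiv ℝ S.η p x) (fderiv ℝ S.f p y) :=
    hh.eq_neg_hessian hp
  have hdet : h v v * h w w - h v w * h w v < 0 := by
    rw [hh.symm hp w v]
    nlinarith [mul_self_nonneg (h v w), mul_pos hv (neg_pos.2 hw)]
  simp only [hform, hDv, hDw, map_add, map_smul, LinearMap.add_apply, LinearMap.smul_apply,
    smul_eq_mul] at hdet
  refine neg_of_mul_neg_left (b := _) ?_ hgram.le
  linarith
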